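/- Variational characterization of minimal surfaces (the example's Hamilton principle): A smooth φ : (Fin 2 → ℝ) → ℝ is critical for the area functional — meaning that for every compactly supported smooth Z : (Fin 2 → ℝ) → ℝ, the function t ↦ ∫ ( W_{φ+t·Z}(x) − W_φ(x) ) dx (integral over (Fin 2 → ℝ) with respect to Lebesgue measure) has derivative 0 at t = 0 — if and only if φ satisfies the minimal surface equation at every point. -/

import Mathlib

open MeasureTheory

/-- Partial derivative of a real-valued function on `Fin 2 → ℝ` in the `i`-th
coordinate direction. -/
noncomputable def pd (f : (Fin 2 → ℝ) → ℝ) (i : Fin 2) (x : Fin 2 → ℝ) : ℝ :=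
  fderiv ℝ f x (Pi.single i 1)

/-- Second partial derivative `∂²f/∂x^i∂x^j`. -/
noncomputable def pd2 (f : (Fin 2 → ℝ) → ℝ) (i j : Fin 2) (x : Fin 2 → ℝ) : ℝ :=
  pd (fun x' => pd f j x') i x

/-- The area density `W_φ = (1 + φ₁² + φ₂²)^{1/2}`. -/
noncomputable def Wd (f : (Fin 2 → ℝ) → ℝ) (x : Fin 2 → ℝ) : ℝ :=
  Real.sqrt (1 + pd f 0 x ^ 2 + pd f 1 x ^ 2)

open scoped ContDiff

lemma contDiff_pd {f : (Fin 2 → ℝ) → ℝ} (hf : ContDiff ℝ ∞ f) (i : Fin 2) :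
    ContDiff ℝ ∞ (pd f i) :=
  (hf.fderiv_right (m := ∞) (by simp)).clm_apply contDiff_const

lemma hasCompactSupport_pd {f : (Fin 2 → ℝ) → ℝ} (hf : HasCompactSupport f) (i : Fin 2) :
    HasCompactSupport (pd f i) :=
  hf.fderiv_apply ℝ _

lemma pd_add_smul {f g : (Fin 2 → ℝ) → ℝ} (hf : Differentiable ℝ f) (hg : Differentiable ℝ g)
    (t : ℝ) (i : Fin 2) (x : Fin 2 → ℝ) : pd (f + t • g) i x = pd f i x + t * pd g i x := by
  unfold pd
  rw [fderiv_add (hf x) ((hg x).const_smul t), fderiv_const_smul (hg x)]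
  simp

lemma pd2_comm {f : (Fin 2 → ℝ) → ℝ} (hf : ContDiff ℝ ∞ f) (i j : Fin 2) (x : Fin 2 → ℝ) :
    pd2 f i j x = pd2 f j i x := by
  have hd : DifferentiableAt ℝ (fderiv ℝ f) x :=
    (hf.fderiv_right (m := ∞) (by simp)).differentiable (by simp) x
  have key (i j : Fin 2) :
      pd2 f i j x = fderiv ℝ (fderiv ℝ f) x (Pi.single i 1) (Pi.single j 1) := by
    unfold pd2 pd
    rw [fderiv_clm_apply hd (differentiableAt_const _)]
    simp
  rw [key, key]
  exact (hf.contDiffAt.isSymmSndFDerivAt (by simp; exact WithTop.coe_le_coe.2 le_top)) _ _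

lemma one_add_sq_add_sq_pos (a b : ℝ) : 0 < 1 + a ^ 2 + b ^ 2 := by positivity

lemma Wd_pos (f : (Fin 2 → ℝ) → ℝ) (x : Fin 2 → ℝ) : 0 < Wd f x :=
  Real.sqrt_pos.2 (one_add_sq_add_sq_pos _ _)

lemma Wd_sq (f : (Fin 2 → ℝ) → ℝ) (x : Fin 2 → ℝ) :
    Wd f x ^ 2 = 1 + pd f 0 x ^ 2 + pd f 1 x ^ 2 :=
  Real.sq_sqrt (one_add_sq_add_sq_pos _ _).le

lemma contDiff_Wd {f : (Fin 2 → ℝ) → ℝ} (hf : ContDiff ℝ ∞ f) : ContDiff ℝ ∞ (Wd f) :=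
  ((contDiff_const.add ((contDiff_pd hf 0).pow 2)).add ((contDiff_pd hf 1).pow 2)).sqrt
    fun _ => (one_add_sq_add_sq_pos _ _).ne'

/-- The component `φ_i / W_φ` of the horizontal part of the unit normal. -/
noncomputable def normalComp (f : (Fin 2 → ℝ) → ℝ) (i : Fin 2) (x : Fin 2 → ℝ) : ℝ :=
  pd f i x / Wd f x

lemma contDiff_normalComp {f : (Fin 2 → ℝ) → ℝ} (hf : ContDiff ℝ ∞ f) (i : Fin 2) :
    ContDiff ℝ ∞ (normalComp f i) :=
  (contDiff_pd hf i).div (contDiff_Wd hf) fun x => (Wd_pos f x).ne'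

lemma pd_Wd {f : (Fin 2 → ℝ) → ℝ} (hf : ContDiff ℝ ∞ f) (j : Fin 2) (x : Fin 2 → ℝ) :
    pd (Wd f) j x = (pd f 0 x * pd2 f j 0 x + pd f 1 x * pd2 f j 1 x) / Wd f x := by
  have h (i : Fin 2) := ((contDiff_pd hf i).differentiable (by simp) x).hasFDerivAt
  have hW : HasFDerivAt (Wd f) _ x := ((((h 0).pow 2).const_add 1).add ((h 1).pow 2)).sqrt
    (one_add_sq_add_sq_pos _ _).ne'
  have hx := (Wd_pos f x).ne'
  unfold pd2
  rw [pd, hW.fderiv]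
  change _ = (pd f 0 x * fderiv ℝ (pd f 0) x (Pi.single j 1) +
    pd f 1 x * fderiv ℝ (pd f 1) x (Pi.single j 1)) / Wd f x
  have hs : √(1 + pd f 0 x ^ 2 + pd f 1 x ^ 2) = Wd f x := rfl
  simp [hs]
  field_simp

lemma pd_normalComp {f : (Fin 2 → ℝ) → ℝ} (hf : ContDiff ℝ ∞ f) (i j : Fin 2) (x : Fin 2 → ℝ) :
    pd (normalComp f i) j x = (pd2 f j i x * Wd f x - pd f i x * pd (Wd f) j x) / Wd f x ^ 2 := by
  have h := ((contDiff_pd hf i).differentiable (by simp) x).hasFDerivAt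
  have hW := ((contDiff_Wd hf).differentiable (by simp) x).hasFDerivAt
  have hx := (Wd_pos f x).ne'
  have hs := h.fun_mul ((hasDerivAt_inv hx).comp_hasFDerivAt x hW)
  have hq : normalComp f i = fun y => pd f i y * (Inv.inv ∘ Wd f) y := by
    ext y
    simp [normalComp, div_eq_mul_inv]
  unfold pd2
  rw [pd, hq, hs.fderiv]
  change _ = (fderiv ℝ (pd f i) x (Pi.single j 1) * Wd f x -
    pd f i x * fderiv ℝ (Wd f) x (Pi.single j 1)) / Wd f x ^ 2
  simp
  field_simp
  ring

/-- The divergence of `∇φ / W_φ` is the minimal surface operator divided by `W_φ ^ 3`. -/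
lemma divergence_normalComp {f : (Fin 2 → ℝ) → ℝ} (hf : ContDiff ℝ ∞ f) (x : Fin 2 → ℝ) :
    pd (normalComp f 0) 0 x + pd (normalComp f 1) 1 x =
      ((1 + pd f 0 x ^ 2) * pd2 f 1 1 x + (1 + pd f 1 x ^ 2) * pd2 f 0 0 x
        - 2 * pd f 0 x * pd f 1 x * pd2 f 0 1 x) / Wd f x ^ 3 := by
  have hx := (Wd_pos f x).ne'
  rw [pd_normalComp hf, pd_normalComp hf, pd_Wd hf, pd_Wd hf, pd2_comm hf 1 0]
  field_simp
  rw [Wd_sq]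
  ring

lemma integral_mul_pd {f g : (Fin 2 → ℝ) → ℝ} (hf : ContDiff ℝ ∞ f) (hg : ContDiff ℝ ∞ g)
    (hgs : HasCompactSupport g) (i : Fin 2) :
    ∫ x, f x * pd g i x = -∫ x, pd f i x * g x :=
  integral_mul_fderiv_eq_neg_fderiv_mul_of_integrable
    (((contDiff_pd hf i).continuous.mul hg.continuous).integrable_of_hasCompactSupport
      hgs.mul_left)
    ((hf.continuous.mul (contDiff_pd hg i).continuous).integrable_of_hasCompactSupport
      (hasCompactSupport_pd hgs i).mul_left)
    ((hf.continuous.mul hg.continuous).integrable_of_hasCompactSupport hgs.mul_left)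
    (fun x _ => hf.differentiable (by simp) x) (fun x _ => hg.differentiable (by simp) x)

lemma abs_div_sqrt_le_one (a b : ℝ) : |a / √(1 + a ^ 2 + b ^ 2)| ≤ 1 := by
  rw [abs_div, abs_of_nonneg (Real.sqrt_nonneg _)]
  refine div_le_one_of_le₀ (Real.abs_le_sqrt ?_) (Real.sqrt_nonneg _)
  nlinarith [sq_nonneg b]

lemma hasDerivAt_area {f Z : (Fin 2 → ℝ) → ℝ} (hf : ContDiff ℝ ∞ f) (hZ : ContDiff ℝ ∞ Z)
    (hZs : HasCompactSupport Z) :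
    HasDerivAt (fun t : ℝ => ∫ x, (Wd (f + t • Z) x - Wd f x))
      (∫ x, (normalComp f 0 x * pd Z 0 x + normalComp f 1 x * pd Z 1 x)) 0 := by
  have hsm (t : ℝ) : ContDiff ℝ ∞ (f + t • Z) := hf.add (hZ.const_smul t)
  have hlin (t : ℝ) (i : Fin 2) (x : Fin 2 → ℝ) :
      pd (f + t • Z) i x = pd f i x + t * pd Z i x :=
    pd_add_smul (hf.differentiable (by simp)) (hZ.differentiable (by simp)) t i x
  have hint (i : Fin 2) : Integrable (fun x => |pd Z i x|) :=
    ((contDiff_pd hZ i).continuous.integrable_of_hasCompactSupport (hasCompactSupport_pd hZs i)).abs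
  have key := (hasDerivAt_integral_of_dominated_loc_of_deriv_le
    (μ := volume) (x₀ := (0 : ℝ)) (s := Set.univ)
    (F := fun t x => Wd (f + t • Z) x - Wd f x)
    (F' := fun t x => normalComp (f + t • Z) 0 x * pd Z 0 x + normalComp (f + t • Z) 1 x * pd Z 1 x)
    (bound := fun x => |pd Z 0 x| + |pd Z 1 x|) Filter.univ_mem
    (.of_forall fun t =>
      ((contDiff_Wd (hsm t)).continuous.sub (contDiff_Wd hf).continuous).aestronglyMeasurable)
    (by simp)
    (((contDiff_normalComp (hsm 0) 0).continuous.mul (contDiff_pd hZ 0).continuous).add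
      ((contDiff_normalComp (hsm 0) 1).continuous.mul
        (contDiff_pd hZ 1).continuous)).aestronglyMeasurable
    (.of_forall fun x t _ => ?_) ((hint 0).add (hint 1)) (.of_forall fun x t _ => ?_)).2
  · simpa using key
  · have h0 : |normalComp (f + t • Z) 0 x| ≤ 1 := abs_div_sqrt_le_one _ _
    have h1 : |normalComp (f + t • Z) 1 x| ≤ 1 := by
      have := abs_div_sqrt_le_one (pd (f + t • Z) 1 x) (pd (f + t • Z) 0 x)
      rwa [add_right_comm] at this
    refine (norm_add_le _ _).trans (add_le_add ?_ ?_) <;> rw [norm_mul]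
    · exact mul_le_of_le_one_left (norm_nonneg _) h0
    · exact mul_le_of_le_one_left (norm_nonneg _) h1
  · have hl (i : Fin 2) :
        HasDerivAt (fun t : ℝ => pd f i x + t * pd Z i x) (pd Z i x) t := by
      simpa using ((hasDerivAt_id t).mul_const (pd Z i x)).const_add (pd f i x)
    have hd := (((((hl 0).fun_pow 2).const_add 1).fun_add ((hl 1).fun_pow 2)).sqrt
      (one_add_sq_add_sq_pos _ _).ne').sub_const (Wd f x)
    have hW := (Wd_pos (f + t • Z) x).ne'
    simp only [normalComp]
    simp only [Wd, hlin] at hW ⊢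
    convert! hd using 1
    field_simp
    simp
    ring

lemma integral_normalComp_mul_pd {f Z : (Fin 2 → ℝ) → ℝ} (hf : ContDiff ℝ ∞ f)
    (hZ : ContDiff ℝ ∞ Z) (hZs : HasCompactSupport Z) :
    ∫ x, (normalComp f 0 x * pd Z 0 x + normalComp f 1 x * pd Z 1 x) =
      -∫ x, Z x * (pd (normalComp f 0) 0 x + pd (normalComp f 1) 1 x) := by
  have h1 (i : Fin 2) : Integrable (fun x => normalComp f i x * pd Z i x) :=
    ((contDiff_normalComp hf i).continuous.mul (contDiff_pd hZ i).continuous)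
      |>.integrable_of_hasCompactSupport (hasCompactSupport_pd hZs i).mul_left
  have h2 (i : Fin 2) : Integrable (fun x => pd (normalComp f i) i x * Z x) :=
    ((contDiff_pd (contDiff_normalComp hf i) i).continuous.mul hZ.continuous)
      |>.integrable_of_hasCompactSupport hZs.mul_left
  rw [integral_add (h1 0) (h1 1), integral_mul_pd (contDiff_normalComp hf 0) hZ hZs,
    integral_mul_pd (contDiff_normalComp hf 1) hZ hZs, ← neg_add, ← integral_add (h2 0) (h2 1)]
  simp only [mul_comm (Z _), add_mul]

/-- Variational characterization of minimal surfaces. -/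
theorem minimal_surface_variational_characterization
    (φ : (Fin 2 → ℝ) → ℝ) (hφ : ContDiff ℝ (⊤ : ℕ∞) φ) :
    (∀ Z : (Fin 2 → ℝ) → ℝ, ContDiff ℝ (⊤ : ℕ∞) Z → HasCompactSupport Z →
      HasDerivAt
        (fun t : ℝ => ∫ x : Fin 2 → ℝ, (Wd (φ + t • Z) x - Wd φ x)) 0 0) ↔
    (∀ x : Fin 2 → ℝ,
      (1 + pd φ 0 x ^ 2) * pd2 φ 1 1 x + (1 + pd φ 1 x ^ 2) * pd2 φ 0 0 x
        - 2 * pd φ 0 x * pd φ 1 x * pd2 φ 0 1 x = 0) := by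
  constructor
  · intro h
    have hc : Continuous fun x => pd (normalComp φ 0) 0 x + pd (normalComp φ 1) 1 x :=
      (contDiff_pd (contDiff_normalComp hφ 0) 0).continuous.add
        (contDiff_pd (contDiff_normalComp hφ 1) 1).continuous
    have hae := ae_eq_zero_of_integral_contDiff_smul_eq_zero (μ := volume)
      hc.locallyIntegrable fun Z hZ hZs => by
        have := (hasDerivAt_area hφ hZ hZs).unique (h Z hZ hZs)
        rwa [integral_normalComp_mul_pd hφ hZ hZs, neg_eq_zero] at this
    intro x
    have hx := congrFun (hc.ae_eq_iff_eq volume continuous_const |>.1 hae) x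
    rw [divergence_normalComp hφ, div_eq_zero_iff] at hx
    exact hx.resolve_right (pow_ne_zero 3 (Wd_pos φ x).ne')
  · intro h Z hZ hZs
    have hd := hasDerivAt_area hφ hZ hZs
    rw [integral_normalComp_mul_pd hφ hZ hZs] at hd
    simpa [divergence_normalComp hφ, h] using hd
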